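/- For every α ∈ ℂ, the tuple (f_0,…,f_5) with f_j(t) = t/3 for all j = 0,…,5 is a rational solution of Type C of the system A_5(α, 1/3 − α, α, 1/3 − α, α, 1/3 − α), and it is the unique rational solution of Type C of this system: any rational solution (g_0,…,g_5) of A_5(α, 1/3 − α, α, 1/3 − α, α, 1/3 − α) in which all six components have a pole at t=∞ satisfies g_j(t) = t/3 for all j. -/

import Mathlib

open Filter Topology Polynomial

noncomputable section

/-- Evaluation of a complex rational function at a point (junk value where the
reduced denominator vanishes). -/
def evalR (f : RatFunc ℂ) (t : ℂ) : ℂ := RatFunc.eval (RingHom.id ℂ) t f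

/-- `f` is defined at `t`: the reduced denominator does not vanish at `t`. -/
def DefinedAt (f : RatFunc ℂ) (t : ℂ) : Prop := Polynomial.eval t (RatFunc.denom f) ≠ 0

/-- `(f 0, …, f 5)` is a rational solution of the `A₅⁽¹⁾` Painlevé system `A₅(α)`:
the two constraints hold identically as rational functions, and the six ODEs hold at
every point where all six components are defined.  (Indices are taken in `Fin 6`,
i.e. modulo `6`.) -/
def IsA5Solution (α : Fin 6 → ℂ) (f : Fin 6 → RatFunc ℂ) : Prop :=
  f 0 + f 2 + f 4 = RatFunc.X ∧
  f 1 + f 3 + f 5 = RatFunc.X ∧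
  ∀ t : ℂ, (∀ j : Fin 6, DefinedAt (f j) t) → ∀ i : Fin 6,
    t / 2 * deriv (evalR (f i)) t =
      evalR (f i) t *
        (evalR (f (i + 1)) t * evalR (f (i + 2)) t
          + evalR (f (i + 1)) t * evalR (f (i + 4)) t
          + evalR (f (i + 3)) t * evalR (f (i + 4)) t
          - evalR (f (i + 2)) t * evalR (f (i + 3)) t
          - evalR (f (i + 2)) t * evalR (f (i + 5)) t
          - evalR (f (i + 4)) t * evalR (f (i + 5)) t)
      + (1 / 2 - α (i + 2) - α (i + 4)) * evalR (f i) t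
      + α i * (evalR (f (i + 2)) t + evalR (f (i + 4)) t)

/-- `f` has a pole at `t = ∞`: `‖f t‖ → ∞` as `‖t‖ → ∞`. -/
def PoleAtInfty (f : RatFunc ℂ) : Prop :=
  Tendsto (fun t => ‖evalR f t‖) (Bornology.cobounded ℂ) atTop

/-- `f` is holomorphic at `t = ∞`: `f` is bounded as `‖t‖ → ∞`. -/
def HoloAtInfty (f : RatFunc ℂ) : Prop :=
  IsBoundedUnder (· ≤ ·) (Bornology.cobounded ℂ) fun t => ‖evalR f t‖

/-- `f` has a pole at `c ∈ ℂ`: `‖f t‖ → ∞` as `t → c`. -/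
def PoleAt (f : RatFunc ℂ) (c : ℂ) : Prop :=
  Tendsto (fun t => ‖evalR f t‖) (𝓝[≠] c) atTop

/-- `f` is regular at `c ∈ ℂ`: it extends continuously to `c`. -/
def RegularAt (f : RatFunc ℂ) (c : ℂ) : Prop :=
  ∃ L : ℂ, Tendsto (fun t => evalR f t) (𝓝[≠] c) (𝓝 L)

/-- `z` is an integer. -/
def IsInt (z : ℂ) : Prop := ∃ n : ℤ, z = (n : ℂ)

/-- `z` is an even integer. -/
def IsEvenInt (z : ℂ) : Prop := ∃ n : ℤ, z = 2 * (n : ℂ)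

/-- A tuple of rational functions has pole configuration of Type A at `t = ∞`. -/
def TypeA (f : Fin 6 → RatFunc ℂ) : Prop :=
  ∃ i : Fin 6,
    (PoleAtInfty (f i) ∧ PoleAtInfty (f (i + 1)) ∧ HoloAtInfty (f (i + 2)) ∧
      HoloAtInfty (f (i + 3)) ∧ HoloAtInfty (f (i + 4)) ∧ HoloAtInfty (f (i + 5))) ∨
    (PoleAtInfty (f i) ∧ PoleAtInfty (f (i + 3)) ∧ HoloAtInfty (f (i + 1)) ∧
      HoloAtInfty (f (i + 2)) ∧ HoloAtInfty (f (i + 4)) ∧ HoloAtInfty (f (i + 5))) ∨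
    (PoleAtInfty (f i) ∧ PoleAtInfty (f (i + 1)) ∧ PoleAtInfty (f (i + 2)) ∧
      PoleAtInfty (f (i + 4)) ∧ HoloAtInfty (f (i + 3)) ∧ HoloAtInfty (f (i + 5)))

/-- A tuple of rational functions has pole configuration of Type B at `t = ∞`. -/
def TypeB (f : Fin 6 → RatFunc ℂ) : Prop :=
  ∃ i : Fin 6,
    PoleAtInfty (f i) ∧ PoleAtInfty (f (i + 1)) ∧ PoleAtInfty (f (i + 2)) ∧
    PoleAtInfty (f (i + 3)) ∧ HoloAtInfty (f (i + 4)) ∧ HoloAtInfty (f (i + 5))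


/-- `f` is a quotient `p / q` of polynomials with `q t ≠ 0` and `p t / q t = v`. -/
def HasVal (f : RatFunc ℂ) (t v : ℂ) : Prop :=
  ∃ p q : ℂ[X], q.eval t ≠ 0 ∧
    f * algebraMap ℂ[X] (RatFunc ℂ) q = algebraMap ℂ[X] (RatFunc ℂ) p ∧
    v * q.eval t = p.eval t

lemma HasVal.add {f g : RatFunc ℂ} {t v w : ℂ} (hf : HasVal f t v) (hg : HasVal g t w) :
    HasVal (f + g) t (v + w) := by
  obtain ⟨p, q, hq, h, e⟩ := hf
  obtain ⟨p', q', hq', h', e'⟩ := hg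
  refine ⟨p * q' + p' * q, q * q', by simp [hq, hq'], ?_, ?_⟩
  · simp only [map_add, map_mul, ← h, ← h']; ring
  · simp only [eval_add, eval_mul, ← e, ← e']; ring

lemma HasVal.mul {f g : RatFunc ℂ} {t v w : ℂ} (hf : HasVal f t v) (hg : HasVal g t w) :
    HasVal (f * g) t (v * w) := by
  obtain ⟨p, q, hq, h, e⟩ := hf
  obtain ⟨p', q', hq', h', e'⟩ := hg
  refine ⟨p * p', q * q', by simp [hq, hq'], ?_, ?_⟩
  · simp only [map_mul, ← h, ← h']; ring
  · simp only [eval_mul, ← e, ← e']; ring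

lemma hasVal_C (c t : ℂ) : HasVal (RatFunc.C c) t c :=
  ⟨Polynomial.C c, 1, by simp, by simp, by simp⟩

lemma hasVal_X (t : ℂ) : HasVal RatFunc.X t t :=
  ⟨Polynomial.X, 1, by simp, by simp, by simp⟩

lemma HasVal.sub {f g : RatFunc ℂ} {t v w : ℂ} (hf : HasVal f t v) (hg : HasVal g t w) :
    HasVal (f - g) t (v - w) := by
  have h := hf.add ((hasVal_C (-1) t).mul hg)
  simpa [sub_eq_add_neg] using h

lemma evalR_eq (f : RatFunc ℂ) (t : ℂ) : evalR f t = f.num.eval t / f.denom.eval t := rfl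

lemma algebraMap_denom_ne_zero (f : RatFunc ℂ) :
    algebraMap ℂ[X] (RatFunc ℂ) f.denom ≠ 0 :=
  RatFunc.algebraMap_ne_zero f.denom_ne_zero

lemma mul_algebraMap_denom (f : RatFunc ℂ) :
    f * algebraMap ℂ[X] (RatFunc ℂ) f.denom = algebraMap ℂ[X] (RatFunc ℂ) f.num := by
  rw [← eq_div_iff (algebraMap_denom_ne_zero f), RatFunc.num_div_denom]

lemma DefinedAt.hasVal {f : RatFunc ℂ} {t : ℂ} (h : DefinedAt f t) : HasVal f t (evalR f t) :=
  ⟨f.num, f.denom, h, mul_algebraMap_denom f, by rw [evalR_eq, div_mul_cancel₀ _ h]⟩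

lemma eventually_definedAt (f : RatFunc ℂ) : ∀ᶠ t in cofinite, DefinedAt f t := by
  refine (f.denom.rootSet_finite ℂ).subset fun t ht => ?_
  simpa [Polynomial.mem_rootSet, f.denom_ne_zero, DefinedAt] using ht

lemma eq_zero_of_eventually_hasVal {f : RatFunc ℂ} (h : ∀ᶠ t in cofinite, HasVal f t 0) :
    f = 0 := by
  rw [← RatFunc.num_eq_zero_iff]
  refine Polynomial.eq_zero_of_infinite_isRoot _ (Set.Infinite.mono ?_ (Set.Finite.infinite_compl h))
  intro t ht
  obtain ⟨p, q, hq, h, e⟩ : HasVal f t 0 := by simpa using ht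
  have h2 : f.num * q = p * f.denom := by
    apply RatFunc.algebraMap_injective ℂ
    rw [map_mul, map_mul, ← mul_algebraMap_denom, ← h]; ring
  have h3 := congrArg (Polynomial.eval t) h2
  rw [eval_mul, eval_mul, ← e] at h3
  simpa [hq] using h3

/-- The derivative of a rational function. -/
def derivR (f : RatFunc ℂ) : RatFunc ℂ :=
  algebraMap ℂ[X] (RatFunc ℂ) (derivative f.num * f.denom - f.num * derivative f.denom) /
    algebraMap ℂ[X] (RatFunc ℂ) (f.denom ^ 2)

lemma DefinedAt.hasVal_derivR {f : RatFunc ℂ} {t : ℂ} (h : DefinedAt f t) :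
    HasVal (derivR f) t (deriv (evalR f) t) := by
  refine ⟨_, f.denom ^ 2, by rw [eval_pow]; exact pow_ne_zero 2 h, div_mul_cancel₀ _ ?_, ?_⟩
  · simpa using f.denom_ne_zero
  · have hd : HasDerivAt (evalR f) ((eval t (derivative f.num) * eval t f.denom
        - eval t f.num * eval t (derivative f.denom)) / eval t f.denom ^ 2) t :=
      (f.num.hasDerivAt t).div (f.denom.hasDerivAt t) h
    rw [hd.deriv, eval_pow, div_mul_cancel₀ _ (pow_ne_zero 2 h)]
    simp

/-- `f` is zero or has degree at most `n` at infinity. -/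
def DegLE (n : ℤ) (f : RatFunc ℂ) : Prop := f = 0 ∨ f.intDegree ≤ n

lemma DegLE.mono {m n : ℤ} {f : RatFunc ℂ} (h : DegLE m f) (hmn : m ≤ n) : DegLE n f :=
  h.imp_right fun h => h.trans hmn

lemma DegLE.add {n : ℤ} {f g : RatFunc ℂ} (hf : DegLE n f) (hg : DegLE n g) :
    DegLE n (f + g) := by
  rcases eq_or_ne g 0 with rfl | hg0
  · simpa using hf
  rcases hf with rfl | hf
  · simpa using hg
  by_cases h : f + g = 0
  · exact Or.inl h
  · exact Or.inr ((RatFunc.intDegree_add_le hg0 h).trans (max_le hf (hg.resolve_left hg0)))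

lemma DegLE.mul {m n : ℤ} {f g : RatFunc ℂ} (hf : DegLE m f) (hg : DegLE n g) :
    DegLE (m + n) (f * g) := by
  by_cases hf0 : f = 0
  · exact Or.inl (by simp [hf0])
  by_cases hg0 : g = 0
  · exact Or.inl (by simp [hg0])
  right
  rw [RatFunc.intDegree_mul hf0 hg0]
  exact add_le_add (hf.resolve_left hf0) (hg.resolve_left hg0)

lemma degLE_X : DegLE 1 RatFunc.X := Or.inr RatFunc.intDegree_X.le

lemma DegLE.const_mul {n : ℤ} {f : RatFunc ℂ} (hf : DegLE n f) (c : ℂ) :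
    DegLE n (RatFunc.C c * f) := by
  have h : DegLE 0 (RatFunc.C c) := Or.inr (RatFunc.intDegree_C c).le
  simpa using h.mul hf

lemma DegLE.sub {n : ℤ} {f g : RatFunc ℂ} (hf : DegLE n f) (hg : DegLE n g) :
    DegLE n (f - g) := by
  simpa [sub_eq_add_neg] using hf.add (hg.const_mul (-1))

lemma DegLE.of_mul {m n : ℤ} {f g : RatFunc ℂ} (h : DegLE n (f * g)) (hf : f ≠ 0)
    (hm : m ≤ f.intDegree) : DegLE (n - m) g := by
  rcases eq_or_ne g 0 with hg | hg
  · exact Or.inl hg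
  have h1 := h.resolve_left (mul_ne_zero hf hg)
  rw [RatFunc.intDegree_mul hf hg] at h1
  exact Or.inr (by lia)

lemma DegLE.of_mul_X {n : ℤ} {f : RatFunc ℂ} (h : DegLE n (RatFunc.X * f)) : DegLE (n - 1) f :=
  h.of_mul RatFunc.X_ne_zero RatFunc.intDegree_X.ge

lemma degLE_div_iff {n : ℤ} {p q : ℂ[X]} (hq : q ≠ 0) :
    DegLE n (algebraMap ℂ[X] (RatFunc ℂ) p / algebraMap ℂ[X] (RatFunc ℂ) q) ↔
      p = 0 ∨ (p.natDegree : ℤ) ≤ q.natDegree + n := by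
  rcases eq_or_ne p 0 with rfl | hp
  · simp [DegLE]
  have hp' := RatFunc.algebraMap_ne_zero hp
  have hq' := RatFunc.algebraMap_ne_zero hq
  rw [DegLE, RatFunc.intDegree_div hp' hq', RatFunc.intDegree_polynomial,
    RatFunc.intDegree_polynomial, div_eq_zero_iff]
  simp only [hp', hq', hp, false_or, or_self]
  lia

/-- The operator `X * d/dX` does not raise the degree, applied here to `f - c * X`. -/
lemma DegLE.X_mul_derivR_sub {n : ℤ} {f : RatFunc ℂ} (c : ℂ)
    (h : DegLE n (f - RatFunc.C c * RatFunc.X)) :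
    DegLE n (RatFunc.X * (derivR f - RatFunc.C c)) := by
  have hd := algebraMap_denom_ne_zero f
  set r := f.num - Polynomial.C c * Polynomial.X * f.denom with hr
  have e1 : f - RatFunc.C c * RatFunc.X =
      algebraMap ℂ[X] (RatFunc ℂ) r / algebraMap ℂ[X] (RatFunc ℂ) f.denom := by
    rw [eq_div_iff hd, sub_mul, mul_algebraMap_denom]
    simp [hr]
  have e2 : RatFunc.X * (derivR f - RatFunc.C c) =
      algebraMap ℂ[X] (RatFunc ℂ) (Polynomial.X * (derivative r * f.denom - r * derivative f.denom))
        / algebraMap ℂ[X] (RatFunc ℂ) (f.denom ^ 2) := by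
    have hd2 : algebraMap ℂ[X] (RatFunc ℂ) (f.denom ^ 2) ≠ 0 := by simpa using f.denom_ne_zero
    rw [eq_div_iff hd2, derivR, mul_assoc, sub_mul, div_mul_cancel₀ _ hd2, ← RatFunc.algebraMap_X,
      ← RatFunc.algebraMap_C, ← map_mul, ← map_sub, ← map_mul]
    refine congrArg (algebraMap ℂ[X] (RatFunc ℂ)) ?_
    simp only [hr, derivative_sub, derivative_mul, derivative_C, derivative_X]
    ring
  rw [e1, degLE_div_iff f.denom_ne_zero] at h
  rw [e2, degLE_div_iff (pow_ne_zero 2 f.denom_ne_zero)]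
  rcases h with h | h
  · left; simp [h]
  rw [or_iff_not_imp_left]
  intro hne
  have hs : derivative r * f.denom - r * derivative f.denom ≠ 0 := right_ne_zero_of_mul hne
  have hlt : (derivative r * f.denom - r * derivative f.denom).natDegree <
      r.natDegree + f.denom.natDegree := by
    have h1 : (derivative r * f.denom - r * derivative f.denom).natDegree ≤
        r.natDegree + f.denom.natDegree - 1 := by
      have h0 := natDegree_derivative_le r
      have h0' := natDegree_derivative_le f.denom
      rcases Nat.eq_zero_or_pos r.natDegree with h2 | h2
      · have h3 : derivative r = 0 := derivative_of_natDegree_zero h2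
        rw [h3, zero_mul, zero_sub, natDegree_neg]
        exact natDegree_mul_le.trans (by lia)
      rcases Nat.eq_zero_or_pos f.denom.natDegree with h4 | h4
      · have h5 : derivative f.denom = 0 := derivative_of_natDegree_zero h4
        rw [h5, mul_zero, sub_zero]
        exact natDegree_mul_le.trans (by lia)
      exact (natDegree_sub_le_of_le (natDegree_mul_le.trans (add_le_add_left h0 _))
        (natDegree_mul_le.trans (add_le_add_right h0' _))).trans (by lia)
    have h2 : r.natDegree + f.denom.natDegree ≠ 0 := by
      intro h2
      apply hs
      rw [derivative_of_natDegree_zero (p := r) (by lia),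
        derivative_of_natDegree_zero (p := f.denom) (by lia)]
      simp
    lia
  rw [natDegree_mul X_ne_zero hs, natDegree_X, natDegree_pow]
  push_cast
  lia

lemma tendsto_eval_div_pow_cobounded (p : ℂ[X]) :
    Tendsto (fun t => p.eval t / t ^ p.natDegree) (Bornology.cobounded ℂ) (𝓝 p.leadingCoeff) := by
  have h1 : Tendsto (fun t : ℂ => p.reverse.eval t⁻¹) (Bornology.cobounded ℂ)
      (𝓝 (p.reverse.eval 0)) :=
    (p.reverse.continuous.tendsto 0).comp tendsto_inv₀_cobounded
  rw [← coeff_zero_eq_eval_zero, coeff_zero_reverse] at h1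
  refine h1.congr' ?_
  filter_upwards [Bornology.eventually_ne_cobounded 0] with t ht0
  let := invertibleOfNonzero ht0
  have h2 := eval₂_reverse_mul_pow (RingHom.id ℂ) t p
  rw [eq_div_iff (pow_ne_zero _ ht0)]
  simpa [eval₂_id, invOf_eq_inv] using h2

lemma PoleAtInfty.one_le_intDegree {f : RatFunc ℂ} (h : PoleAtInfty f) : 1 ≤ f.intDegree := by
  by_contra! hlt
  have hle : f.num.natDegree ≤ f.denom.natDegree := by
    rw [RatFunc.intDegree] at hlt
    lia
  have hq := (tendsto_eval_div_pow_cobounded f.denom).inv₀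
    (leadingCoeff_ne_zero.2 f.denom_ne_zero)
  have hpow : Tendsto (fun t : ℂ => t⁻¹ ^ (f.denom.natDegree - f.num.natDegree))
      (Bornology.cobounded ℂ) (𝓝 (0 ^ (f.denom.natDegree - f.num.natDegree))) :=
    tendsto_inv₀_cobounded.pow _
  have hlim := (((tendsto_eval_div_pow_cobounded f.num).mul hq).mul hpow).norm
  refine not_tendsto_nhds_of_tendsto_atTop h _ (hlim.congr' ?_)
  filter_upwards [Bornology.eventually_ne_cobounded 0] with t ht0
  congr 1
  rw [evalR_eq]
  obtain ⟨k, hk⟩ := Nat.exists_eq_add_of_le hle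
  rw [hk, Nat.add_sub_cancel_left, pow_add, inv_pow]
  field_simp

lemma PoleAtInfty.ne_zero {f : RatFunc ℂ} (h : PoleAtInfty f) : f ≠ 0 := by
  rintro rfl
  simpa using h.one_le_intDegree

/-- The quadratic form multiplying `g i` in the `i`-th equation of the system. -/
def quadR (g : Fin 6 → RatFunc ℂ) (i : Fin 6) : RatFunc ℂ :=
  g (i + 1) * g (i + 2) + g (i + 1) * g (i + 4) + g (i + 3) * g (i + 4)
    - g (i + 2) * g (i + 3) - g (i + 2) * g (i + 5) - g (i + 4) * g (i + 5)

lemma IsA5Solution.sum_eq_X {α : Fin 6 → ℂ} {g : Fin 6 → RatFunc ℂ} (h : IsA5Solution α g)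
    (i : Fin 6) : g i + g (i + 2) + g (i + 4) = RatFunc.X := by
  obtain ⟨h0, h1, -⟩ := h
  fin_cases i <;> simp <;> first
    | linear_combination h0
    | linear_combination h1

lemma IsA5Solution.derivR_eq {α : Fin 6 → ℂ} {g : Fin 6 → RatFunc ℂ} (h : IsA5Solution α g)
    (i : Fin 6) :
    RatFunc.C (1 / 2) * RatFunc.X * derivR (g i) =
      g i * quadR g i + RatFunc.C (1 / 2 - α (i + 2) - α (i + 4)) * g i
        + RatFunc.C (α i) * (g (i + 2) + g (i + 4)) := by
  rw [← sub_eq_zero]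
  apply eq_zero_of_eventually_hasVal
  filter_upwards [eventually_all.2 fun j => eventually_definedAt (g j)] with t ht
  have hv := fun j => (ht j).hasVal
  have hode := h.2.2 t ht i
  have hval := ((((hasVal_C (1 / 2) t).mul (hasVal_X t)).mul (ht i).hasVal_derivR).sub
    ((((hv i).mul (((((((hv (i + 1)).mul (hv (i + 2))).add ((hv (i + 1)).mul (hv (i + 4)))).add
      ((hv (i + 3)).mul (hv (i + 4)))).sub ((hv (i + 2)).mul (hv (i + 3)))).sub
      ((hv (i + 2)).mul (hv (i + 5)))).sub ((hv (i + 4)).mul (hv (i + 5))))).add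
      ((hasVal_C (1 / 2 - α (i + 2) - α (i + 4)) t).mul (hv i))).add
      ((hasVal_C (α i) t).mul ((hv (i + 2)).add (hv (i + 4))))))
  rw [quadR]
  convert! hval using 1
  linear_combination -hode

lemma DegLE.sub_of_quadR {g : Fin 6 → RatFunc ℂ} {n m : ℤ}
    (hsum : ∀ i, g i + g (i + 2) + g (i + 4) = RatFunc.X)
    (hg : ∀ i, DegLE n (g i - RatFunc.C (1 / 3) * RatFunc.X)) (hm : m ≤ 0) (hmn : m ≤ n - 1)
    (hquad : ∀ i, DegLE m (quadR g i)) : DegLE (n - 1) (g 5 - g 3) := by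
  have hC3 : RatFunc.C (1 / 3 : ℂ) * 3 = 1 := by
    rw [← map_ofNat RatFunc.C 3, ← map_mul]; norm_num
  have hC3' : RatFunc.C (3 : ℂ) = 3 := map_ofNat _ 3
  have hC6 : RatFunc.C (6 : ℂ) = 6 := map_ofNat _ 6
  set c := RatFunc.C (1 / 3 : ℂ)
  have s0 : g 0 + g 2 + g 4 = RatFunc.X := hsum 0
  have s1 : g 1 + g 3 + g 5 = RatFunc.X := hsum 1
  have q0 : DegLE m (g 1 * g 2 + g 1 * g 4 + g 3 * g 4 - g 2 * g 3 - g 2 * g 5 - g 4 * g 5) :=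
    hquad 0
  have q1 : DegLE m (g 2 * g 3 + g 2 * g 5 + g 4 * g 5 - g 3 * g 4 - g 3 * g 0 - g 5 * g 0) :=
    hquad 1
  have q2 : DegLE m (g 3 * g 4 + g 3 * g 0 + g 5 * g 0 - g 4 * g 5 - g 4 * g 1 - g 0 * g 1) :=
    hquad 2
  have q3 : DegLE m (g 4 * g 5 + g 4 * g 1 + g 0 * g 1 - g 5 * g 0 - g 5 * g 2 - g 1 * g 2) :=
    hquad 3
  have q4 : DegLE m (g 5 * g 0 + g 5 * g 2 + g 1 * g 2 - g 0 * g 1 - g 0 * g 3 - g 2 * g 3) :=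
    hquad 4
  have q5 : DegLE m (g 0 * g 1 + g 0 * g 3 + g 2 * g 3 - g 1 * g 2 - g 1 * g 4 - g 3 * g 4) :=
    hquad 5
  have d14 : DegLE (m - 1) (g 5 - g 3 + g 2 - g 0) := by
    apply DegLE.of_mul_X
    convert! q1.add q4 using 1
    linear_combination (-(g 5 - g 3)) * s0 - (g 2 - g 0) * s1
  have d30 : DegLE (m - 1) (g 1 - g 5 + g 4 - g 2) := by
    apply DegLE.of_mul_X
    convert! q3.add q0 using 1
    linear_combination (-(g 1 - g 5)) * s0 - (g 4 - g 2) * s1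
  have d52 : DegLE (m - 1) (g 3 - g 1 + g 0 - g 4) := by
    apply DegLE.of_mul_X
    convert! q5.add q2 using 1
    linear_combination (-(g 3 - g 1)) * s0 - (g 0 - g 4) * s1
  have w0 : DegLE (m - 1) (g 0 + g 3 - 2 * c * RatFunc.X) := by
    convert! (d52.sub d14).const_mul (1 / 3) using 1
    linear_combination (-(g 0 + g 3)) * hC3 + c * (s0 + s1)
  have w2 : DegLE (m - 1) (g 2 + g 5 - 2 * c * RatFunc.X) := by
    convert! (d14.sub d30).const_mul (1 / 3) using 1
    linear_combination (-(g 2 + g 5)) * hC3 + c * (s0 + s1)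
  have hX := degLE_X
  have key : DegLE (max m (m - 1 + n)) (RatFunc.X * (g 5 - g 3)) := by
    have b1 := (q4.const_mul 3).mono (le_max_left m (m - 1 + n))
    have b2 := (hX.mul (w2.sub w0)).mono (n := max m (m - 1 + n)) (by lia)
    have b3 := (((w0.mul (hg 5)).sub (w2.mul (hg 3))).const_mul 6).mono (le_max_right m (m - 1 + n))
    convert! (b1.sub b2).sub b3 using 1
    rw [hC3', hC6]
    linear_combination (-3 * (g 2 - g 0)) * s1 - 2 * RatFunc.X * (g 0 - g 2 + g 5 - g 3) * hC3
  exact key.of_mul_X.mono (by lia)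

lemma DegLE.step {g : Fin 6 → RatFunc ℂ} {n m : ℤ}
    (hsum : ∀ i, g i + g (i + 2) + g (i + 4) = RatFunc.X)
    (hg : ∀ i, DegLE n (g i - RatFunc.C (1 / 3) * RatFunc.X)) (hm : m ≤ 0) (hmn : m ≤ n - 1)
    (hquad : ∀ i, DegLE m (quadR g i)) (i : Fin 6) :
    DegLE (n - 1) (g i - RatFunc.C (1 / 3) * RatFunc.X) := by
  have hC3 : RatFunc.C (1 / 3 : ℂ) * 3 = 1 := by
    rw [← map_ofNat RatFunc.C 3, ← map_mul]; norm_num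
  have hrot (k : Fin 6) : DegLE (n - 1) (g (k + 5) - g (k + 3)) :=
    DegLE.sub_of_quadR (g := fun j => g (k + j))
      (fun j => by simpa only [add_assoc] using hsum (k + j)) (fun j => hg (k + j)) hm hmn
      (fun j => by simpa only [quadR, add_assoc] using hquad (k + j))
  have e1 := hrot (i + 3)
  have e2 := hrot (i + 1)
  rw [add_assoc, add_assoc, show (3 + 5 : Fin 6) = 2 from rfl, show (3 + 3 : Fin 6) = 0 from rfl,
    add_zero] at e1
  rw [add_assoc, add_assoc, show (1 + 5 : Fin 6) = 0 from rfl, show (1 + 3 : Fin 6) = 4 from rfl,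
    add_zero] at e2
  convert! (e2.sub e1).const_mul (1 / 3) using 1
  linear_combination (-g i) * hC3 + RatFunc.C (1 / 3) * hsum i

lemma IsA5Solution.degLE_quadR {α : Fin 6 → ℂ} {g : Fin 6 → RatFunc ℂ} (h : IsA5Solution α g)
    (hα : ∀ i, α (i + 2) = α i) (hpole : ∀ i, PoleAtInfty (g i)) {n : ℤ}
    (hg : ∀ i, DegLE n (g i - RatFunc.C (1 / 3) * RatFunc.X)) (i : Fin 6) :
    DegLE (min 0 (n - 1)) (quadR g i) := by
  have hα4 : α (i + 4) = α i := by
    rw [show i + 4 = i + 2 + 2 by rw [add_assoc]; rfl, hα, hα]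
  have hode := h.derivR_eq i
  rw [hα, hα4] at hode
  have hsum := h.sum_eq_X i
  have hC3 : RatFunc.C (1 / 3 : ℂ) * 3 = 1 := by
    rw [← map_ofNat RatFunc.C 3, ← map_mul]; norm_num
  have hdeg := (hpole i).one_le_intDegree
  have key0 : DegLE (g i).intDegree (g i * quadR g i) := by
    have hself : DegLE (g i).intDegree (g i) := Or.inr le_rfl
    have hd := DegLE.X_mul_derivR_sub (n := (g i).intDegree) (f := g i) 0 (by simpa using hself)
    convert! ((hd.const_mul (1 / 2)).sub (hself.const_mul (1 / 2 - 3 * α i))).sub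
      ((degLE_X.mono hdeg).const_mul (α i)) using 1
    simp only [map_sub, map_mul, map_zero, map_ofNat] at hode ⊢
    linear_combination -hode - RatFunc.C (α i) * hsum
  have key1 : DegLE n (g i * quadR g i) := by
    convert! ((DegLE.X_mul_derivR_sub _ (hg i)).const_mul (1 / 2)).sub
      ((hg i).const_mul (1 / 2 - 3 * α i)) using 1
    simp only [map_sub, map_mul, map_ofNat] at hode ⊢
    linear_combination -hode - RatFunc.C (α i) * hsum + RatFunc.C (α i) * RatFunc.X * hC3
  rcases min_cases 0 (n - 1) with ⟨e, -⟩ | ⟨e, -⟩ <;> rw [e]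
  · simpa using key0.of_mul (hpole i).ne_zero le_rfl
  · exact key1.of_mul (hpole i).ne_zero hdeg

lemma IsA5Solution.eq_of_poleAtInfty {α : Fin 6 → ℂ} {g : Fin 6 → RatFunc ℂ}
    (h : IsA5Solution α g) (hα : ∀ i, α (i + 2) = α i) (hpole : ∀ i, PoleAtInfty (g i))
    (j : Fin 6) : g j = RatFunc.C (1 / 3) * RatFunc.X := by
  obtain ⟨n, hn⟩ : ∃ n : ℤ, ∀ i, DegLE n (g i - RatFunc.C (1 / 3) * RatFunc.X) := by
    obtain ⟨n, hn⟩ := (Set.finite_range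
      fun i => (g i - RatFunc.C (1 / 3) * RatFunc.X).intDegree).bddAbove
    exact ⟨n, fun i => Or.inr (hn ⟨i, rfl⟩)⟩
  have hall (k : ℕ) : ∀ i, DegLE (n - k) (g i - RatFunc.C (1 / 3) * RatFunc.X) := by
    induction k with
    | zero => simpa using hn
    | succ k ih =>
      intro i
      have := DegLE.step h.sum_eq_X ih (min_le_left _ _) (min_le_right _ _)
        (h.degLE_quadR hα hpole ih) i
      exact this.mono (by push_cast; lia)
  set u := g j - RatFunc.C (1 / 3) * RatFunc.X with hu
  rcases hall (n - u.intDegree + 1).toNat j with h0 | h0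
  · exact sub_eq_zero.1 h0
  · lia

lemma evalR_C_mul_X (c t : ℂ) : evalR (RatFunc.C c * RatFunc.X) t = c * t := by
  rw [← RatFunc.algebraMap_C, ← RatFunc.algebraMap_X, ← map_mul, evalR_eq,
    RatFunc.num_algebraMap, RatFunc.denom_algebraMap]
  simp

lemma X_div_three : (RatFunc.X : RatFunc ℂ) / 3 = RatFunc.C (1 / 3) * RatFunc.X := by
  rw [map_div₀, map_one, map_ofNat]
  ring

/-- For every `a ∈ ℂ`, `(t/3, …, t/3)` is the unique rational solution of Type C of
`A₅(a, 1/3 − a, a, 1/3 − a, a, 1/3 − a)`. -/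
theorem stmt_19 (a : ℂ) :
    (IsA5Solution ![a, 1 / 3 - a, a, 1 / 3 - a, a, 1 / 3 - a]
        (fun _ => RatFunc.X / 3) ∧
      ∀ j : Fin 6, PoleAtInfty ((fun _ : Fin 6 => (RatFunc.X : RatFunc ℂ) / 3) j)) ∧
    (∀ g : Fin 6 → RatFunc ℂ,
        IsA5Solution ![a, 1 / 3 - a, a, 1 / 3 - a, a, 1 / 3 - a] g →
        (∀ j : Fin 6, PoleAtInfty (g j)) →
        ∀ j : Fin 6, g j = RatFunc.X / 3) := by
  have hα : ∀ i : Fin 6, (![a, 1 / 3 - a, a, 1 / 3 - a, a, 1 / 3 - a] : Fin 6 → ℂ) (i + 2) =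
      (![a, 1 / 3 - a, a, 1 / 3 - a, a, 1 / 3 - a] : Fin 6 → ℂ) i := by
    intro i
    fin_cases i <;> rfl
  simp only [X_div_three]
  refine ⟨⟨⟨?_, ?_, fun t _ i => ?_⟩, fun _ => ?_⟩, fun g hg hpole => hg.eq_of_poleAtInfty hα hpole⟩
  · rw [← X_div_three]; ring
  · rw [← X_div_three]; ring
  · have hd : deriv (evalR (RatFunc.C (1 / 3) * RatFunc.X)) t = 1 / 3 := by
      rw [funext (evalR_C_mul_X (1 / 3)), deriv_const_mul_field, deriv_id'']
      simp
    have hα4 := (hα (i + 2)).trans (hα i)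
    rw [add_assoc, show (2 + 2 : Fin 6) = 4 from rfl] at hα4
    rw [hd, hα4, hα]
    simp only [evalR_C_mul_X]
    ring
  · simp only [PoleAtInfty, evalR_C_mul_X, norm_mul]
    exact tendsto_norm_cobounded_atTop.const_mul_atTop (by simp)
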